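/- Let 𝒳, 𝒴, 𝓑 be finite sets, π_{XY} a distribution on 𝒳×𝒴, and let Ψ : ℝ → [0,+∞] be defined as the minimum, over finite auxiliary alphabets 𝒰, 𝒱 and distributions P_{UV}, P_{B|XUV}, P_{Y|BUV} satisfying H(U|V) ≤ H(BU|XYV) + t, of D(P_{Y|XV} ‖ π_{Y|X} | π_X P_V), with entropies evaluated under π_X P_{UV} P_{B|XUV} P_{Y|BUV}. Let t_min be the infimum of the set of t ∈ ℝ with Ψ(t) < +∞. Then Ψ(t) = +∞ for all t < t_min, and Ψ is continuous on the open interval (t_min, +∞). -/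

import Mathlib

open scoped BigOperators ENNReal
open Classical

noncomputable section

/-- `p` is a probability mass function on the finite type `α`. -/
def IsDist {α : Type} [Fintype α] (p : α → ℝ) : Prop :=
  (∀ a, 0 ≤ p a) ∧ (∑ a, p a) = 1

/-- `k` is a conditional probability kernel. -/
def IsKernel {α β : Type} [Fintype β] (k : α → β → ℝ) : Prop :=
  ∀ a, (∀ b, 0 ≤ k a b) ∧ (∑ b, k a b) = 1

/-- Marginal (pushforward) of `p` along the map `f`. -/
def marg {α β : Type} [Fintype α] (f : α → β) (p : α → ℝ) : β → ℝ :=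
  fun b => ∑ a, if f a = b then p a else 0

/-- Shannon entropy (natural log). -/
def ent {α : Type} [Fintype α] (p : α → ℝ) : ℝ :=
  ∑ a, Real.negMulLog (p a)

/-- Conditional entropy `H(f(A) | g(A))` for `A ∼ p`. -/
def condEnt {α β γ : Type} [Fintype α] [Fintype β] [Fintype γ]
    (f : α → β) (g : α → γ) (p : α → ℝ) : ℝ :=
  ent (marg (fun a => (f a, g a)) p) - ent (marg g p)

/-- Kullback–Leibler divergence `D(p‖q)` with value `⊤` if `p` is not absolutely
continuous with respect to `q`. -/
def KL {α : Type} [Fintype α] (p q : α → ℝ) : ℝ≥0∞ :=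
  if ∀ a, q a = 0 → p a = 0 then ENNReal.ofReal (∑ a, p a * Real.log (p a / q a)) else ⊤

/-- The joint distribution `π_X P_{UV} P_{B|XUV} P_{Y|BUV}` on `X × U × V × B × Y`. -/
def seqJoint {X Y B U V : Type} (πX : X → ℝ) (PUV : U × V → ℝ)
    (PB : X × U × V → B → ℝ) (PY : B × U × V → Y → ℝ) : X × U × V × B × Y → ℝ :=
  fun q => πX q.1 * PUV (q.2.1, q.2.2.1) * PB (q.1, q.2.1, q.2.2.1) q.2.2.2.1 *
    PY (q.2.2.2.1, q.2.1, q.2.2.1) q.2.2.2.2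

/-- The set of values `D(P_{Y|XV} ‖ π_{Y|X} | π_X P_V)` over all feasible tuples
`(𝒰, 𝒱, P_{UV}, P_{B|XUV}, P_{Y|BUV})` with `H(U|V) ≤ H(BU|XYV) + t`. -/
def psiSet (X Y B : Type) [Fintype X] [Fintype Y] [Fintype B] (π : X × Y → ℝ) (t : ℝ) :
    Set ℝ≥0∞ :=
  { d | ∃ (m l : ℕ) (PUV : Fin m × Fin l → ℝ)
      (PB : X × Fin m × Fin l → B → ℝ) (PY : B × Fin m × Fin l → Y → ℝ),
      IsDist PUV ∧ IsKernel PB ∧ IsKernel PY ∧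
      condEnt (fun q : X × Fin m × Fin l × B × Y => q.2.1)
          (fun q => q.2.2.1) (seqJoint (marg Prod.fst π) PUV PB PY) ≤
        condEnt (fun q : X × Fin m × Fin l × B × Y => (q.2.2.2.1, q.2.1))
          (fun q => (q.1, q.2.2.2.2, q.2.2.1)) (seqJoint (marg Prod.fst π) PUV PB PY) + t ∧
      d = KL (marg (fun q : X × Fin m × Fin l × B × Y => (q.1, q.2.2.1, q.2.2.2.2))
              (seqJoint (marg Prod.fst π) PUV PB PY))
            (fun r : X × Fin l × Y => marg Prod.snd PUV r.2.1 * π (r.1, r.2.2)) }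

/-- `Ψ(t)`, with the convention `Ψ(t) = ⊤` when there is no feasible tuple. -/
def Psi (X Y B : Type) [Fintype X] [Fintype Y] [Fintype B] (π : X × Y → ℝ) (t : ℝ) : ℝ≥0∞ :=
  sInf (psiSet X Y B π t)

/-- The function `p` is supported on the disjoint images of `i₁` and `i₂`, where it is given by
`c₁ • p₁` and `c₂ • p₂` respectively. -/
structure IsMix {α₁ α₂ α : Type} (i₁ : α₁ → α) (i₂ : α₂ → α) (c₁ c₂ : ℝ)
    (p₁ : α₁ → ℝ) (p₂ : α₂ → ℝ) (p : α → ℝ) : Prop where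
  inj_left : Function.Injective i₁
  inj_right : Function.Injective i₂
  disjoint : ∀ a b, i₁ a ≠ i₂ b
  apply_left : ∀ a, p (i₁ a) = c₁ * p₁ a
  apply_right : ∀ a, p (i₂ a) = c₂ * p₂ a
  apply_of_notMem : ∀ a, (∀ b, i₁ b ≠ a) → (∀ b, i₂ b ≠ a) → p a = 0

namespace IsMix

variable {α₁ α₂ α : Type} [Fintype α₁] [Fintype α₂] [Fintype α]
  {β₁ β₂ β : Type} {i₁ : α₁ → α} {i₂ : α₂ → α} {c₁ c₂ : ℝ}
  {p₁ : α₁ → ℝ} {p₂ : α₂ → ℝ} {p : α → ℝ}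

theorem sum_comp (h : IsMix i₁ i₂ c₁ c₂ p₁ p₂ p) (F : α → ℝ → ℝ) (hF : ∀ a, F a 0 = 0) :
    ∑ a, F a (p a) = ∑ a, F (i₁ a) (c₁ * p₁ a) + ∑ a, F (i₂ a) (c₂ * p₂ a) := by
  have hinj : Function.Injective (Sum.elim i₁ i₂) :=
    h.inj_left.sumElim h.inj_right h.disjoint
  have key : ∑ s, F (Sum.elim i₁ i₂ s) (p (Sum.elim i₁ i₂ s)) = ∑ a, F a (p a) := by
    refine Finset.sum_of_injOn (Sum.elim i₁ i₂) hinj.injOn (by simp) ?_ (by simp)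
    intro a _ ha
    rw [h.apply_of_notMem a (fun b hb => ha ⟨Sum.inl b, by simp, hb⟩)
      (fun b hb => ha ⟨Sum.inr b, by simp, hb⟩), hF]
  rw [← key, Fintype.sum_sum_type]
  simp only [Sum.elim_inl, Sum.elim_inr, h.apply_left, h.apply_right]

theorem sum_eq (h : IsMix i₁ i₂ c₁ c₂ p₁ p₂ p) :
    ∑ a, p a = c₁ * ∑ a, p₁ a + c₂ * ∑ a, p₂ a := by
  rw [h.sum_comp (fun _ x => x) (fun _ => rfl), Finset.mul_sum, Finset.mul_sum]

theorem marg (h : IsMix i₁ i₂ c₁ c₂ p₁ p₂ p) {f : α → β} {f₁ : α₁ → β₁} {f₂ : α₂ → β₂}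
    {j₁ : β₁ → β} {j₂ : β₂ → β} (hj₁ : Function.Injective j₁) (hj₂ : Function.Injective j₂)
    (hj : ∀ a b, j₁ a ≠ j₂ b) (hf₁ : ∀ a, f (i₁ a) = j₁ (f₁ a)) (hf₂ : ∀ a, f (i₂ a) = j₂ (f₂ a)) :
    IsMix j₁ j₂ c₁ c₂ (_root_.marg f₁ p₁) (_root_.marg f₂ p₂) (_root_.marg f p) := by
  have key : ∀ b, _root_.marg f p b = (∑ a, if j₁ (f₁ a) = b then c₁ * p₁ a else 0) +
      ∑ a, if j₂ (f₂ a) = b then c₂ * p₂ a else 0 := by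
    intro b
    have := h.sum_comp (fun a x => if f a = b then x else 0) (by simp)
    simpa only [hf₁, hf₂, _root_.marg] using this
  refine ⟨hj₁, hj₂, hj, fun b => ?_, fun b => ?_, fun b h₁ h₂ => ?_⟩
  · rw [key]
    simp [hj₁.eq_iff, (hj _ _).symm, _root_.marg, Finset.mul_sum]
  · rw [key]
    simp [hj₂.eq_iff, hj, _root_.marg, Finset.mul_sum]
  · simp [key, h₁, h₂]

theorem ent_eq (h : IsMix i₁ i₂ c₁ c₂ p₁ p₂ p) :
    ent p = c₁ * ent p₁ + c₂ * ent p₂ +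
      (Real.negMulLog c₁ * ∑ a, p₁ a + Real.negMulLog c₂ * ∑ a, p₂ a) := by
  unfold ent
  rw [h.sum_comp (fun _ x => Real.negMulLog x) (by simp)]
  simp only [Real.negMulLog_mul, Finset.sum_add_distrib, Finset.mul_sum]
  simp only [mul_comm]
  ring

end IsMix

theorem sum_marg {α β : Type} [Fintype α] [Fintype β] (f : α → β) (p : α → ℝ) :
    ∑ b, marg f p b = ∑ a, p a := by
  unfold marg
  rw [Finset.sum_comm]
  simp

theorem IsMix.condEnt_eq {α₁ α₂ α β₁ β₂ β γ₁ γ₂ γ : Type}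
    [Fintype α₁] [Fintype α₂] [Fintype α] [Fintype β₁] [Fintype β₂] [Fintype β]
    [Fintype γ₁] [Fintype γ₂] [Fintype γ] {i₁ : α₁ → α} {i₂ : α₂ → α} {c₁ c₂ : ℝ}
    {p₁ : α₁ → ℝ} {p₂ : α₂ → ℝ} {p : α → ℝ} (h : IsMix i₁ i₂ c₁ c₂ p₁ p₂ p)
    {f : α → β} {f₁ : α₁ → β₁} {f₂ : α₂ → β₂} {j₁ : β₁ → β} {j₂ : β₂ → β}
    {g : α → γ} {g₁ : α₁ → γ₁} {g₂ : α₂ → γ₂} {k₁ : γ₁ → γ} {k₂ : γ₂ → γ}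
    (hj₁ : Function.Injective j₁) (hj₂ : Function.Injective j₂)
    (hk₁ : Function.Injective k₁) (hk₂ : Function.Injective k₂) (hk : ∀ a b, k₁ a ≠ k₂ b)
    (hf₁ : ∀ a, f (i₁ a) = j₁ (f₁ a)) (hf₂ : ∀ a, f (i₂ a) = j₂ (f₂ a))
    (hg₁ : ∀ a, g (i₁ a) = k₁ (g₁ a)) (hg₂ : ∀ a, g (i₂ a) = k₂ (g₂ a)) :
    condEnt f g p = c₁ * condEnt f₁ g₁ p₁ + c₂ * condEnt f₂ g₂ p₂ := by
  have h₁ := (h.marg hk₁ hk₂ hk hg₁ hg₂).ent_eq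
  have h₂ := (h.marg (f := fun a => (f a, g a)) (f₁ := fun a => (f₁ a, g₁ a))
    (f₂ := fun a => (f₂ a, g₂ a)) (j₁ := Prod.map j₁ k₁) (j₂ := Prod.map j₂ k₂)
    (hj₁.prodMap hk₁) (hj₂.prodMap hk₂) (fun a b hab => hk a.2 b.2 (congrArg Prod.snd hab))
    (fun a => by simp [hf₁, hg₁]) (fun a => by simp [hf₂, hg₂])).ent_eq
  simp only [sum_marg] at h₁ h₂
  unfold condEnt
  rw [h₁, h₂]
  ring

theorem IsMix.KL_le {α₁ α₂ α : Type} [Fintype α₁] [Fintype α₂] [Fintype α]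
    {i₁ : α₁ → α} {i₂ : α₂ → α} {c₁ c₂ : ℝ} {p₁ q₁ : α₁ → ℝ} {p₂ q₂ : α₂ → ℝ} {p q : α → ℝ}
    (hc₁ : 0 < c₁) (hc₂ : 0 < c₂)
    (hp : IsMix i₁ i₂ c₁ c₂ p₁ p₂ p) (hq : IsMix i₁ i₂ c₁ c₂ q₁ q₂ q) :
    KL p q ≤ ENNReal.ofReal c₁ * KL p₁ q₁ + ENNReal.ofReal c₂ * KL p₂ q₂ := by
  by_cases h₁ : ∀ a, q₁ a = 0 → p₁ a = 0
  swap
  · simp [KL, h₁, ENNReal.mul_top, hc₁]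
  by_cases h₂ : ∀ a, q₂ a = 0 → p₂ a = 0
  swap
  · simp [KL, h₂, ENNReal.mul_top, hc₂]
  have hac : ∀ a, q a = 0 → p a = 0 := by
    intro a ha
    by_cases e₁ : ∃ b, i₁ b = a
    · obtain ⟨b, rfl⟩ := e₁
      rw [hq.apply_left] at ha
      rw [hp.apply_left, h₁ b (by simpa [hc₁.ne'] using ha), mul_zero]
    by_cases e₂ : ∃ b, i₂ b = a
    · obtain ⟨b, rfl⟩ := e₂
      rw [hq.apply_right] at ha
      rw [hp.apply_right, h₂ b (by simpa [hc₂.ne'] using ha), mul_zero]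
    push Not at e₁ e₂
    exact hp.apply_of_notMem a e₁ e₂
  have hs : ∑ a, p a * Real.log (p a / q a) = c₁ * ∑ a, p₁ a * Real.log (p₁ a / q₁ a) +
      c₂ * ∑ a, p₂ a * Real.log (p₂ a / q₂ a) := by
    rw [hp.sum_comp (fun a x => x * Real.log (x / q a)) (by simp)]
    simp only [hq.apply_left, hq.apply_right, mul_div_mul_left _ _ hc₁.ne',
      mul_div_mul_left _ _ hc₂.ne', Finset.mul_sum, mul_assoc]
  unfold KL
  rw [if_pos hac, if_pos h₁, if_pos h₂, hs, ← ENNReal.ofReal_mul hc₁.le,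
    ← ENNReal.ofReal_mul hc₂.le]
  exact ENNReal.ofReal_add_le

/-- Glue functions on the two diagonal blocks, with the value `d` on the off-diagonal blocks. -/
def blockDiag {C : Type} {m₁ m₂ l₁ l₂ : ℕ} (k₁ : Fin m₁ × Fin l₁ → C) (k₂ : Fin m₂ × Fin l₂ → C)
    (d : C) (w : Fin (m₁ + m₂) × Fin (l₁ + l₂)) : C :=
  Fin.addCases (fun u => Fin.addCases (fun v => k₁ (u, v)) (fun _ => d) w.2)
    (fun u => Fin.addCases (fun _ => d) (fun v => k₂ (u, v)) w.2) w.1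

section blockDiag

variable {C : Type} {m₁ m₂ l₁ l₂ : ℕ} (k₁ : Fin m₁ × Fin l₁ → C) (k₂ : Fin m₂ × Fin l₂ → C) (d : C)

@[simp] theorem blockDiag_left (u : Fin m₁) (v : Fin l₁) :
    blockDiag k₁ k₂ d (Fin.castAdd m₂ u, Fin.castAdd l₂ v) = k₁ (u, v) := by
  simp [blockDiag]

@[simp] theorem blockDiag_right (u : Fin m₂) (v : Fin l₂) :
    blockDiag k₁ k₂ d (Fin.natAdd m₁ u, Fin.natAdd l₁ v) = k₂ (u, v) := by
  simp [blockDiag]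

theorem blockDiag_eq_of_notMem (w : Fin (m₁ + m₂) × Fin (l₁ + l₂))
    (h₁ : ∀ u v, (Fin.castAdd m₂ u, Fin.castAdd l₂ v) ≠ w)
    (h₂ : ∀ u v, (Fin.natAdd m₁ u, Fin.natAdd l₁ v) ≠ w) : blockDiag k₁ k₂ d w = d := by
  obtain ⟨u, v⟩ := w
  induction u using Fin.addCases with
  | left u => induction v using Fin.addCases with
    | left v => exact absurd rfl (h₁ u v)
    | right v => simp [blockDiag]
  | right u => induction v using Fin.addCases with
    | left v => simp [blockDiag]
    | right v => exact absurd rfl (h₂ u v)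

theorem blockDiag_induction {P : C → Prop} (h₁ : ∀ w, P (k₁ w)) (h₂ : ∀ w, P (k₂ w)) (hd : P d)
    (w : Fin (m₁ + m₂) × Fin (l₁ + l₂)) : P (blockDiag k₁ k₂ d w) := by
  obtain ⟨u, v⟩ := w
  induction u using Fin.addCases with
  | left u => induction v using Fin.addCases with
    | left v => simpa [blockDiag] using h₁ (u, v)
    | right v => simpa [blockDiag] using hd
  | right u => induction v using Fin.addCases with
    | left v => simpa [blockDiag] using hd
    | right v => simpa [blockDiag] using h₂ (u, v)

end blockDiag

theorem castAdd_ne_natAdd {m n : ℕ} (a : Fin m) (b : Fin n) :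
    Fin.castAdd n a ≠ Fin.natAdd m b := by
  intro h
  have := congrArg Fin.val h
  simp at this
  omega

theorem isMix_blockDiag {m₁ m₂ l₁ l₂ : ℕ} (c₁ c₂ : ℝ) (p₁ : Fin m₁ × Fin l₁ → ℝ)
    (p₂ : Fin m₂ × Fin l₂ → ℝ) :
    IsMix (Prod.map (Fin.castAdd m₂) (Fin.castAdd l₂)) (Prod.map (Fin.natAdd m₁) (Fin.natAdd l₁))
      c₁ c₂ p₁ p₂ (blockDiag (fun w => c₁ * p₁ w) (fun w => c₂ * p₂ w) 0) where
  inj_left := (Fin.castAdd_injective _ _).prodMap (Fin.castAdd_injective _ _)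
  inj_right := (Fin.natAdd_injective _ _).prodMap (Fin.natAdd_injective _ _)
  disjoint a b h := castAdd_ne_natAdd a.1 b.1 (congrArg Prod.fst h)
  apply_left a := by simp [Prod.map]
  apply_right a := by simp [Prod.map]
  apply_of_notMem a h₁ h₂ :=
    blockDiag_eq_of_notMem _ _ _ _ (fun u v => h₁ (u, v)) (fun u v => h₂ (u, v))

/-- Time sharing: the joint law built from block-diagonal data is a mixture of the joint laws. -/
theorem isMix_seqJoint {X Y B : Type} {m₁ m₂ l₁ l₂ : ℕ} (c₁ c₂ : ℝ) (πX : X → ℝ)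
    (p₁ : Fin m₁ × Fin l₁ → ℝ) (p₂ : Fin m₂ × Fin l₂ → ℝ)
    (b₁ : X × Fin m₁ × Fin l₁ → B → ℝ) (b₂ : X × Fin m₂ × Fin l₂ → B → ℝ) (b₀ : X → B → ℝ)
    (y₁ : B × Fin m₁ × Fin l₁ → Y → ℝ) (y₂ : B × Fin m₂ × Fin l₂ → Y → ℝ) (y₀ : B → Y → ℝ) :
    IsMix (fun q => (q.1, Fin.castAdd m₂ q.2.1, Fin.castAdd l₂ q.2.2.1, q.2.2.2))
      (fun q => (q.1, Fin.natAdd m₁ q.2.1, Fin.natAdd l₁ q.2.2.1, q.2.2.2)) c₁ c₂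
      (seqJoint πX p₁ b₁ y₁) (seqJoint πX p₂ b₂ y₂)
      (seqJoint πX (blockDiag (fun w => c₁ * p₁ w) (fun w => c₂ * p₂ w) 0)
        (fun z => blockDiag (fun w => b₁ (z.1, w)) (fun w => b₂ (z.1, w)) (b₀ z.1) z.2)
        (fun z => blockDiag (fun w => y₁ (z.1, w)) (fun w => y₂ (z.1, w)) (y₀ z.1) z.2)) where
  inj_left := by
    rintro ⟨x, u, v, b, y⟩ ⟨x', u', v', b', y'⟩ h
    simpa using h
  inj_right := by
    rintro ⟨x, u, v, b, y⟩ ⟨x', u', v', b', y'⟩ h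
    simpa using h
  disjoint a b h := castAdd_ne_natAdd a.2.1 b.2.1 (congrArg (fun q => q.2.1) h)
  apply_left a := by
    simp only [seqJoint, blockDiag_left]
    ring
  apply_right a := by
    simp only [seqJoint, blockDiag_right]
    ring
  apply_of_notMem a h₁ h₂ := by
    obtain ⟨x, u, v, r⟩ := a
    have h0 : blockDiag (fun w => c₁ * p₁ w) (fun w => c₂ * p₂ w) 0 (u, v) = 0 := by
      refine blockDiag_eq_of_notMem _ _ _ _ (fun u' v' h => h₁ (x, u', v', r) ?_)
        (fun u' v' h => h₂ (x, u', v', r) ?_) <;>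
      · simp only [Prod.mk.injEq] at h ⊢
        simp [h]
    simp [seqJoint, h0]

theorem exists_mem_psiSet_le {X Y B : Type} [Fintype X] [Fintype Y] [Fintype B] {π : X × Y → ℝ}
    {c₁ c₂ t₁ t₂ : ℝ} (hc₁ : 0 < c₁) (hc₂ : 0 < c₂) (hc : c₁ + c₂ = 1) {d₁ d₂ : ℝ≥0∞}
    (hd₁ : d₁ ∈ psiSet X Y B π t₁) (hd₂ : d₂ ∈ psiSet X Y B π t₂) :
    ∃ d ∈ psiSet X Y B π (c₁ * t₁ + c₂ * t₂),
      d ≤ ENNReal.ofReal c₁ * d₁ + ENNReal.ofReal c₂ * d₂ := by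
  obtain ⟨m₁, l₁, p₁, b₁, y₁, hp₁, hb₁, hy₁, he₁, rfl⟩ := hd₁
  obtain ⟨m₂, l₂, p₂, b₂, y₂, hp₂, hb₂, hy₂, he₂, rfl⟩ := hd₂
  obtain ⟨w₀⟩ : Nonempty (Fin m₁ × Fin l₁) := by
    by_contra h
    rw [not_nonempty_iff] at h
    simpa using hp₁.2
  have hmP := isMix_blockDiag c₁ c₂ p₁ p₂
  have hm := isMix_seqJoint c₁ c₂ (marg Prod.fst π) p₁ p₂ b₁ b₂ (fun x => b₁ (x, w₀))
    y₁ y₂ (fun b => y₁ (b, w₀))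
  refine ⟨_, ⟨m₁ + m₂, l₁ + l₂, _, _, _, ⟨fun w => ?_, ?_⟩, fun z => ?_, fun z => ?_, ?_, rfl⟩,
    IsMix.KL_le hc₁ hc₂ (hm.marg (j₁ := fun r => (r.1, Fin.castAdd l₂ r.2.1, r.2.2))
      (j₂ := fun r => (r.1, Fin.natAdd l₁ r.2.1, r.2.2)) ?_ ?_ ?_ (fun _ => rfl) (fun _ => rfl)) ?_⟩
  · exact blockDiag_induction (P := fun x => 0 ≤ x) _ _ _ (fun w => mul_nonneg hc₁.le (hp₁.1 w))
      (fun w => mul_nonneg hc₂.le (hp₂.1 w)) le_rfl w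
  · rw [hmP.sum_eq, hp₁.2, hp₂.2, mul_one, mul_one, hc]
  · exact blockDiag_induction (P := fun k : B → ℝ => (∀ b, 0 ≤ k b) ∧ ∑ b, k b = 1) _ _ _
      (fun w => hb₁ (z.1, w)) (fun w => hb₂ (z.1, w)) (hb₁ (z.1, w₀)) z.2
  · exact blockDiag_induction (P := fun k : Y → ℝ => (∀ b, 0 ≤ k b) ∧ ∑ b, k b = 1) _ _ _
      (fun w => hy₁ (z.1, w)) (fun w => hy₂ (z.1, w)) (hy₁ (z.1, w₀)) z.2
  · rw [hm.condEnt_eq (f₁ := fun q => q.2.1) (f₂ := fun q => q.2.1) (g₁ := fun q => q.2.2.1)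
        (g₂ := fun q => q.2.2.1) (Fin.castAdd_injective _ _) (Fin.natAdd_injective _ _)
        (Fin.castAdd_injective _ _) (Fin.natAdd_injective _ _) castAdd_ne_natAdd
        (fun _ => rfl) (fun _ => rfl) (fun _ => rfl) (fun _ => rfl),
      hm.condEnt_eq (f₁ := fun q => (q.2.2.2.1, q.2.1)) (f₂ := fun q => (q.2.2.2.1, q.2.1))
        (g₁ := fun q => (q.1, q.2.2.2.2, q.2.2.1)) (g₂ := fun q => (q.1, q.2.2.2.2, q.2.2.1))
        (j₁ := Prod.map id (Fin.castAdd m₂)) (j₂ := Prod.map id (Fin.natAdd m₁))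
        (k₁ := Prod.map id (Prod.map id (Fin.castAdd l₂)))
        (k₂ := Prod.map id (Prod.map id (Fin.natAdd l₁)))
        (Function.injective_id.prodMap (Fin.castAdd_injective _ _))
        (Function.injective_id.prodMap (Fin.natAdd_injective _ _))
        (Function.injective_id.prodMap (Function.injective_id.prodMap (Fin.castAdd_injective _ _)))
        (Function.injective_id.prodMap (Function.injective_id.prodMap (Fin.natAdd_injective _ _)))
        (fun a b h => castAdd_ne_natAdd a.2.2 b.2.2 (congrArg (fun r => r.2.2) h))
        (fun _ => rfl) (fun _ => rfl) (fun _ => rfl) (fun _ => rfl)]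
    have e₁ := mul_le_mul_of_nonneg_left he₁ hc₁.le
    have e₂ := mul_le_mul_of_nonneg_left he₂ hc₂.le
    linarith
  · rintro ⟨x, v, y⟩ ⟨x', v', y'⟩ h
    simpa using h
  · rintro ⟨x, v, y⟩ ⟨x', v', y'⟩ h
    simpa using h
  · exact fun a b h => castAdd_ne_natAdd a.2.1 b.2.1 (congrArg (fun r => r.2.1) h)
  · have hV := hmP.marg (f := Prod.snd) (f₁ := Prod.snd) (f₂ := Prod.snd)
      (Fin.castAdd_injective l₁ l₂) (Fin.natAdd_injective l₂ l₁) castAdd_ne_natAdd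
      (fun _ => rfl) (fun _ => rfl)
    refine ⟨?_, ?_, fun a b h => castAdd_ne_natAdd a.2.1 b.2.1 (congrArg (fun r => r.2.1) h),
      fun r => ?_, fun r => ?_, ?_⟩
    · rintro ⟨x, v, y⟩ ⟨x', v', y'⟩ h
      simpa using h
    · rintro ⟨x, v, y⟩ ⟨x', v', y'⟩ h
      simpa using h
    · simp only [hV.apply_left, mul_assoc]
    · simp only [hV.apply_right, mul_assoc]
    · rintro ⟨x, v, y⟩ h₁ h₂
      simp only
      rw [hV.apply_of_notMem v (fun v' h => h₁ (x, v', y) (by simp [h]))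
        (fun v' h => h₂ (x, v', y) (by simp [h])), zero_mul]

theorem Psi_mix_le {X Y B : Type} [Fintype X] [Fintype Y] [Fintype B] (π : X × Y → ℝ)
    {c₁ c₂ : ℝ} (t₁ t₂ : ℝ) (hc₁ : 0 < c₁) (hc₂ : 0 < c₂) (hc : c₁ + c₂ = 1) :
    Psi X Y B π (c₁ * t₁ + c₂ * t₂) ≤
      ENNReal.ofReal c₁ * Psi X Y B π t₁ + ENNReal.ofReal c₂ * Psi X Y B π t₂ := by
  have h₁ : ENNReal.ofReal c₁ ≠ 0 := by simpa using hc₁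
  have h₂ : ENNReal.ofReal c₂ ≠ 0 := by simpa using hc₂
  unfold Psi
  simp only [sInf_eq_iInf', ENNReal.mul_iInf_of_ne h₁ ENNReal.ofReal_ne_top,
    ENNReal.mul_iInf_of_ne h₂ ENNReal.ofReal_ne_top, ENNReal.iInf_add, ENNReal.add_iInf]
  refine le_iInf fun d₂ => le_iInf fun d₁ => ?_
  obtain ⟨d, hd, hle⟩ := exists_mem_psiSet_le hc₁ hc₂ hc d₁.2 d₂.2
  rw [← sInf_eq_iInf']
  exact (sInf_le hd).trans hle

theorem Psi_antitone {X Y B : Type} [Fintype X] [Fintype Y] [Fintype B] (π : X × Y → ℝ) :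
    Antitone (Psi X Y B π) := by
  intro s t hst
  refine sInf_le_sInf ?_
  rintro d ⟨m, l, p, b, y, hp, hb, hy, he, hd⟩
  exact ⟨m, l, p, b, y, hp, hb, hy, he.trans (by linarith), hd⟩

/-- with `t_min` the greatest lower bound of `{t : Ψ(t) < +∞}`,
`Ψ` equals `+∞` below `t_min` and is continuous on `(t_min, +∞)`. -/
theorem Psi_top_below_tmin_and_continuousOn
    (X Y B : Type) [Fintype X] [Fintype Y] [Fintype B]
    (π : X × Y → ℝ) (hπ : IsDist π)
    (tmin : ℝ) (htmin : IsGLB {t : ℝ | Psi X Y B π t < ⊤} tmin) :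
    (∀ t : ℝ, t < tmin → Psi X Y B π t = ⊤) ∧
    ContinuousOn (Psi X Y B π) (Set.Ioi tmin) := by
  refine ⟨fun t ht => ?_, ?_⟩
  · by_contra h
    exact absurd (htmin.1 (lt_top_iff_ne_top.2 h : Psi X Y B π t < ⊤)) (not_le.2 ht)
  have hfin : ∀ t ∈ Set.Ioi tmin, Psi X Y B π t ≠ ⊤ := by
    intro t ht
    obtain ⟨s, hs, hst⟩ := (isGLB_lt_iff htmin).1 ht
    exact ((Psi_antitone π hst.le).trans_lt hs).ne
  have hconv : ConvexOn ℝ (Set.Ioi tmin) (fun t => (Psi X Y B π t).toReal) := by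
    refine convexOn_iff_forall_pos.2 ⟨convex_Ioi _, fun s hs t ht a b ha hb hab => ?_⟩
    have hs' := ENNReal.mul_ne_top (ENNReal.ofReal_ne_top (r := a)) (hfin s hs)
    have ht' := ENNReal.mul_ne_top (ENNReal.ofReal_ne_top (r := b)) (hfin t ht)
    have := ENNReal.toReal_mono (ENNReal.add_ne_top.2 ⟨hs', ht'⟩) (Psi_mix_le π s t ha hb hab)
    rw [ENNReal.toReal_add hs' ht', ENNReal.toReal_mul, ENNReal.toReal_mul,
      ENNReal.toReal_ofReal ha.le, ENNReal.toReal_ofReal hb.le] at this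
    simpa only [smul_eq_mul] using this
  exact (ENNReal.continuous_ofReal.comp_continuousOn (hconv.continuousOn isOpen_Ioi)).congr
    fun t ht => (ENNReal.ofReal_toReal (hfin t ht)).symm

end
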